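/- Let S be a string with smallest period p = per(S), and let V = S[i..j] be a fragment of S of length j-i+1 ≥ 2p. Then per(V) = p. -/

import Mathlib

/-- `p` is a period of the fragment `S[a..b]` (1-indexed, inclusive). -/
def FragPeriod {α : Type*} (S : ℕ → α) (a b p : ℕ) : Prop :=
  1 ≤ p ∧ p ≤ b + 1 - a ∧ ∀ x, a ≤ x → x + p ≤ b → S x = S (x + p)

theorem FragPeriod.eq_add_mul {α : Type*} {S : ℕ → α} {a b p : ℕ} (h : FragPeriod S a b p)
    {x : ℕ} (hx : a ≤ x) (k : ℕ) (hk : x + p * k ≤ b) : S x = S (x + p * k) := by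
  induction k with
  | zero => simp
  | succ k ih =>
    rw [Nat.mul_succ, ← Nat.add_assoc] at hk ⊢
    rw [ih (by omega), h.2.2 (x + p * k) (by omega) hk]

theorem FragPeriod.eq_of_modEq {α : Type*} {S : ℕ → α} {a b p : ℕ} (h : FragPeriod S a b p)
    {x y : ℕ} (hax : a ≤ x) (hxb : x ≤ b) (hay : a ≤ y) (hyb : y ≤ b) (hxy : x ≡ y [MOD p]) :
    S x = S y := by
  wlog hle : x ≤ y generalizing x y
  · exact (this hay hyb hax hxb hxy.symm (by omega)).symm
  obtain ⟨k, hk⟩ := (Nat.modEq_iff_dvd' hle).mp hxy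
  obtain rfl : y = x + p * k := by omega
  exact h.eq_add_mul hax k hyb

theorem FragPeriod.restrict {α : Type*} {S : ℕ → α} {a b i j p : ℕ} (h : FragPeriod S a b p)
    (hai : a ≤ i) (hjb : j ≤ b) (hp : p ≤ j + 1 - i) : FragPeriod S i j p :=
  ⟨h.1, hp, fun x hx hxj => h.2.2 x (hai.trans hx) (hxj.trans hjb)⟩

/-- A period `q ≤ p` of a fragment of length at least `2 * p` extends to any enclosing
fragment having period `p`. -/
theorem FragPeriod.extend {α : Type*} {S : ℕ → α} {a b i j p q : ℕ} (hp : FragPeriod S a b p)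
    (hai : a ≤ i) (hjb : j ≤ b) (hlen : 2 * p ≤ j + 1 - i) (hq : FragPeriod S i j q)
    (hqp : q ≤ p) : FragPeriod S a b q := by
  have hp₁ := hp.1
  refine ⟨hq.1, hqp.trans hp.2.1, fun x hx hxb => ?_⟩
  obtain ⟨y, hiy, hyi, hyx⟩ : ∃ y, i ≤ y ∧ y < i + p ∧ x ≡ y [MOD p] := by
    refine ⟨i + (x + (p - 1) * i) % p, by omega,
      Nat.add_lt_add_left (Nat.mod_lt _ hp₁) i, ?_⟩
    obtain ⟨r, rfl⟩ := Nat.exists_eq_add_of_le' hp₁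
    have h : i + (x + (r + 1 - 1) * i) = x + (r + 1) * i := by
      rw [Nat.add_sub_cancel]; ring
    have h' := (Nat.mod_modEq (x + (r + 1 - 1) * i) (r + 1)).add_left i
    rw [h] at h'
    refine (h'.trans ?_).symm
    simp [Nat.ModEq]
  calc S x = S y := hp.eq_of_modEq hx (by omega) (by omega) (by omega) hyx
    _ = S (y + q) := hq.2.2 y hiy (by omega)
    _ = S (x + q) :=
      hp.eq_of_modEq (by omega) (by omega) (by omega) hxb (hyx.symm.add_right q)

/-- If `S` has smallest period `p` and `V = S[i..j]` is a fragment of `S` of length at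
least `2p`, then the smallest period of `V` is also `p`. -/
theorem statement5 {α : Type*} (S : ℕ → α) (n p i j : ℕ)
    (hi : 1 ≤ i) (hij : i ≤ j) (hj : j ≤ n)
    (hper : IsLeast {q | FragPeriod S 1 n q} p)
    (hlen : 2 * p ≤ j + 1 - i) :
    IsLeast {q | FragPeriod S i j q} p := by
  have hp : FragPeriod S 1 n p := hper.1
  refine ⟨hp.restrict hi hj (by omega), fun q hq => ?_⟩
  by_contra! hqp
  exact absurd (hper.2 (hp.extend hi hj hlen hq hqp.le)) (by omega)
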